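/- Suppose λ₁* > 0, η ≤ 1/(32·λ₁*), and σ₁(X_t) ≤ √(2·λ₁*). Then σ_r(U_{t+1})² ≥ (1 + 2η·(λ_r* − σ₁(J_t)² − σ_r(U_t)²))·σ_r(U_t)² − 4·η²·λ₁*³. -/

import Mathlib

open Matrix

/-- The largest singular value of a real matrix. -/
noncomputable def sigmaMax {m n : ℕ} (M : Matrix (Fin m) (Fin n) ℝ) : ℝ :=
  sSup {c : ℝ | ∃ v : EuclideanSpace ℝ (Fin n), ‖v‖ = 1 ∧
    c = ‖(EuclideanSpace.equiv (Fin m) ℝ).symm (M.mulVec ((EuclideanSpace.equiv (Fin n) ℝ) v))‖}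

/-- The smallest singular value (the `n`-th largest, for a matrix with `n` columns). -/
noncomputable def sigmaMin {m n : ℕ} (M : Matrix (Fin m) (Fin n) ℝ) : ℝ :=
  sInf {c : ℝ | ∃ v : EuclideanSpace ℝ (Fin n), ‖v‖ = 1 ∧
    c = ‖(EuclideanSpace.equiv (Fin m) ℝ).symm (M.mulVec ((EuclideanSpace.equiv (Fin n) ℝ) v))‖}

/-- Frobenius norm of a real matrix. -/
noncomputable def frobNorm {m n : ℕ} (M : Matrix (Fin m) (Fin n) ℝ) : ℝ :=
  Real.sqrt (∑ i, ∑ j, (M i j) ^ 2)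

/-- Gradient descent iterates `X_{t+1} = X_t + η (Σ - X_t X_tᵀ) X_t`. -/
noncomputable def gdIter {d r : ℕ} (S : Matrix (Fin d) (Fin d) ℝ) (η : ℝ)
    (X0 : Matrix (Fin d) (Fin r) ℝ) : ℕ → Matrix (Fin d) (Fin r) ℝ
  | 0 => X0
  | t + 1 => gdIter S η X0 t +
      η • ((S - gdIter S η X0 t * (gdIter S η X0 t)ᵀ) * gdIter S η X0 t)

/-- The top `r × r` block `U` (first `r` rows) of `X ∈ ℝ^{d×r}`. -/
def topBlock {d r : ℕ} (h : r ≤ d) (X : Matrix (Fin d) (Fin r) ℝ) :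
    Matrix (Fin r) (Fin r) ℝ :=
  fun i j => X (Fin.castLE h i) j

/-- The bottom `(d-r) × r` block `J` (last `d-r` rows) of `X ∈ ℝ^{d×r}`. -/
def botBlock {d r : ℕ} (X : Matrix (Fin d) (Fin r) ℝ) :
    Matrix (Fin (d - r)) (Fin r) ℝ :=
  fun i j => X ⟨r + (i : ℕ), by have := i.isLt; omega⟩ j

/-- The region `R = {X : σ₁(X)² ≤ 2λ₁*, σ₁(J)² ≤ λ_r* − Δ/2, σ_r(U)² ≥ Δ/4}`. -/
def inR {d r : ℕ} (h : r ≤ d) (lam1 lamr Δ : ℝ) (X : Matrix (Fin d) (Fin r) ℝ) : Prop :=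
  sigmaMax X ^ 2 ≤ 2 * lam1 ∧ sigmaMax (botBlock X) ^ 2 ≤ lamr - Δ / 2 ∧
    Δ / 4 ≤ sigmaMin (topBlock h X) ^ 2

/-- The region `R₂ = {X : σ₁(X)² ≤ 2λ₁*, σ₁(J)² ≤ λ_r* − Δ/2}`. -/
def inR2 {d r : ℕ} (lam1 lamr Δ : ℝ) (X : Matrix (Fin d) (Fin r) ℝ) : Prop :=
  sigmaMax X ^ 2 ≤ 2 * lam1 ∧ sigmaMax (botBlock X) ^ 2 ≤ lamr - Δ / 2


section SingularValues

variable {m n : ℕ}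

theorem norm_euclideanEquiv_symm_sq (x : Fin n → ℝ) :
    ‖(EuclideanSpace.equiv (Fin n) ℝ).symm x‖ ^ 2 = x ⬝ᵥ x := by
  simp [EuclideanSpace.norm_sq_eq, dotProduct, ← sq]

theorem dotProduct_sq_le (x y : Fin n → ℝ) : (x ⬝ᵥ y) ^ 2 ≤ (x ⬝ᵥ x) * (y ⬝ᵥ y) := by
  simpa only [dotProduct, sq] using Finset.sum_mul_sq_le_sq_mul_sq Finset.univ x y

theorem dotProduct_self_nonneg_real (x : Fin n → ℝ) : 0 ≤ x ⬝ᵥ x :=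
  Finset.sum_nonneg fun i _ => mul_self_nonneg (x i)

/-- The set of norms of images of unit vectors, whose extrema are `sigmaMax` and `sigmaMin`. -/
def unitImageNorms (M : Matrix (Fin m) (Fin n) ℝ) : Set ℝ :=
  {c : ℝ | ∃ v : EuclideanSpace ℝ (Fin n), ‖v‖ = 1 ∧
    c = ‖(EuclideanSpace.equiv (Fin m) ℝ).symm (M.mulVec ((EuclideanSpace.equiv (Fin n) ℝ) v))‖}

theorem nonneg_of_mem_unitImageNorms {M : Matrix (Fin m) (Fin n) ℝ} {c : ℝ}
    (hc : c ∈ unitImageNorms M) : 0 ≤ c := by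
  obtain ⟨v, -, rfl⟩ := hc
  positivity

theorem exists_sq_eq_of_mem_unitImageNorms {M : Matrix (Fin m) (Fin n) ℝ} {c : ℝ}
    (hc : c ∈ unitImageNorms M) :
    ∃ v : Fin n → ℝ, v ⬝ᵥ v = 1 ∧ c ^ 2 = (M *ᵥ v) ⬝ᵥ (M *ᵥ v) := by
  obtain ⟨v, hv, rfl⟩ := hc
  refine ⟨EuclideanSpace.equiv (Fin n) ℝ v, ?_, norm_euclideanEquiv_symm_sq _⟩
  rw [← norm_euclideanEquiv_symm_sq, ContinuousLinearEquiv.symm_apply_apply, hv, one_pow]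

theorem exists_mem_unitImageNorms (M : Matrix (Fin m) (Fin n) ℝ) {v : Fin n → ℝ} (hv : v ≠ 0) :
    ∃ c ∈ unitImageNorms M, (M *ᵥ v) ⬝ᵥ (M *ᵥ v) = c ^ 2 * (v ⬝ᵥ v) := by
  have hN : ‖(EuclideanSpace.equiv (Fin n) ℝ).symm v‖ ≠ 0 := by
    simpa using hv
  set N := ‖(EuclideanSpace.equiv (Fin n) ℝ).symm v‖ with hNdef
  refine ⟨_, ⟨N⁻¹ • (EuclideanSpace.equiv (Fin n) ℝ).symm v, ?_, rfl⟩, ?_⟩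
  · rw [norm_smul, ← hNdef, norm_inv, Real.norm_of_nonneg (norm_nonneg _), inv_mul_cancel₀ hN]
  · rw [norm_euclideanEquiv_symm_sq, ← norm_euclideanEquiv_symm_sq v, ← hNdef, map_smul,
      ContinuousLinearEquiv.apply_symm_apply, mulVec_smul, smul_dotProduct, dotProduct_smul]
    simp only [smul_eq_mul]
    field_simp

theorem unitImageNorms_nonempty (hn : 0 < n) (M : Matrix (Fin m) (Fin n) ℝ) :
    (unitImageNorms M).Nonempty := by
  have h : (fun _ : Fin n => (1 : ℝ)) ≠ 0 := fun h => one_ne_zero (congrFun h ⟨0, hn⟩)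
  obtain ⟨c, hc, -⟩ := exists_mem_unitImageNorms M h
  exact ⟨c, hc⟩

theorem bddAbove_unitImageNorms (M : Matrix (Fin m) (Fin n) ℝ) :
    BddAbove (unitImageNorms M) := by
  refine ⟨√(∑ i, M i ⬝ᵥ M i), ?_⟩
  intro c hc
  obtain ⟨v, hv, hcv⟩ := exists_sq_eq_of_mem_unitImageNorms hc
  refine Real.le_sqrt_of_sq_le ?_
  rw [hcv]
  refine Finset.sum_le_sum fun i _ => ?_
  have h := dotProduct_sq_le (M i) v
  rwa [hv, mul_one, sq] at h

theorem sigmaMin_nonneg (M : Matrix (Fin m) (Fin n) ℝ) : 0 ≤ sigmaMin M :=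
  Real.sInf_nonneg fun _ hc => nonneg_of_mem_unitImageNorms hc

theorem sigmaMax_nonneg (M : Matrix (Fin m) (Fin n) ℝ) : 0 ≤ sigmaMax M :=
  Real.sSup_nonneg fun _ hc => nonneg_of_mem_unitImageNorms hc

theorem sigmaMin_sq_mul_le (M : Matrix (Fin m) (Fin n) ℝ) (v : Fin n → ℝ) :
    sigmaMin M ^ 2 * (v ⬝ᵥ v) ≤ (M *ᵥ v) ⬝ᵥ (M *ᵥ v) := by
  rcases eq_or_ne v 0 with rfl | hv
  · simp
  obtain ⟨c, hc, h⟩ := exists_mem_unitImageNorms M hv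
  have hle : sigmaMin M ≤ c := csInf_le ⟨0, fun _ hx => nonneg_of_mem_unitImageNorms hx⟩ hc
  rw [h]
  exact mul_le_mul_of_nonneg_right (pow_le_pow_left₀ (sigmaMin_nonneg M) hle 2)
    (dotProduct_self_nonneg_real v)

theorem le_sigmaMax_sq_mul (M : Matrix (Fin m) (Fin n) ℝ) (v : Fin n → ℝ) :
    (M *ᵥ v) ⬝ᵥ (M *ᵥ v) ≤ sigmaMax M ^ 2 * (v ⬝ᵥ v) := by
  rcases eq_or_ne v 0 with rfl | hv
  · simp
  obtain ⟨c, hc, h⟩ := exists_mem_unitImageNorms M hv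
  have hle : c ≤ sigmaMax M := le_csSup (bddAbove_unitImageNorms M) hc
  rw [h]
  exact mul_le_mul_of_nonneg_right (pow_le_pow_left₀ (nonneg_of_mem_unitImageNorms hc) hle 2)
    (dotProduct_self_nonneg_real v)

theorem sigmaMax_sq_le {M : Matrix (Fin m) (Fin n) ℝ} {L : ℝ} (hL : 0 ≤ L)
    (h : ∀ v, (M *ᵥ v) ⬝ᵥ (M *ᵥ v) ≤ L * (v ⬝ᵥ v)) : sigmaMax M ^ 2 ≤ L := by
  refine (Real.le_sqrt (sigmaMax_nonneg M) hL).1 (Real.sSup_le ?_ (Real.sqrt_nonneg L))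
  intro c hc
  obtain ⟨v, hv, hcv⟩ := exists_sq_eq_of_mem_unitImageNorms hc
  exact Real.le_sqrt_of_sq_le (by simpa [hcv, hv] using h v)

theorem le_sigmaMin_sq (hn : 0 < n) {M : Matrix (Fin m) (Fin n) ℝ} {T : ℝ}
    (h : ∀ v, T * (v ⬝ᵥ v) ≤ (M *ᵥ v) ⬝ᵥ (M *ᵥ v)) : T ≤ sigmaMin M ^ 2 := by
  refine Real.sqrt_le_left (sigmaMin_nonneg M) |>.1 (le_csInf (unitImageNorms_nonempty hn M) ?_)
  intro c hc
  obtain ⟨v, hv, hcv⟩ := exists_sq_eq_of_mem_unitImageNorms hc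
  exact (Real.sqrt_le_left (nonneg_of_mem_unitImageNorms hc)).2 (by simpa [hcv, hv] using h v)

theorem mulVec_dotProduct_eq (M : Matrix (Fin m) (Fin n) ℝ) (x : Fin n → ℝ) (y : Fin m → ℝ) :
    (M *ᵥ x) ⬝ᵥ y = x ⬝ᵥ (Mᵀ *ᵥ y) := by
  rw [mulVec_transpose, dotProduct_comm, dotProduct_mulVec, dotProduct_comm]

theorem transpose_mulVec_dotProduct_eq (M : Matrix (Fin m) (Fin n) ℝ) (x : Fin m → ℝ)
    (y : Fin n → ℝ) : (Mᵀ *ᵥ x) ⬝ᵥ y = x ⬝ᵥ (M *ᵥ y) := by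
  rw [mulVec_dotProduct_eq, transpose_transpose]

/-- An upper bound on the gain of a matrix passes to its transpose. -/
theorem transpose_mulVec_sq_le {M : Matrix (Fin m) (Fin n) ℝ} {L : ℝ} (hL : 0 ≤ L)
    (h : ∀ v, (M *ᵥ v) ⬝ᵥ (M *ᵥ v) ≤ L * (v ⬝ᵥ v)) (x : Fin m → ℝ) :
    (Mᵀ *ᵥ x) ⬝ᵥ (Mᵀ *ᵥ x) ≤ L * (x ⬝ᵥ x) := by
  have h1 := dotProduct_sq_le x (M *ᵥ (Mᵀ *ᵥ x))
  rw [← transpose_mulVec_dotProduct_eq] at h1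
  have h2 := h (Mᵀ *ᵥ x)
  have hx := dotProduct_self_nonneg_real x
  have ha := dotProduct_self_nonneg_real (Mᵀ *ᵥ x)
  set a := (Mᵀ *ᵥ x) ⬝ᵥ (Mᵀ *ᵥ x)
  rcases ha.eq_or_lt with h0 | h0
  · rw [← h0]; positivity
  · have h3 := mul_le_mul_of_nonneg_left h2 hx
    refine le_of_mul_le_mul_right ?_ h0
    linarith

/-- A lower bound on the gain of a square matrix passes to its transpose. -/
theorem le_transpose_mulVec_sq {M : Matrix (Fin n) (Fin n) ℝ} {T : ℝ}
    (h : ∀ v, T * (v ⬝ᵥ v) ≤ (M *ᵥ v) ⬝ᵥ (M *ᵥ v)) (x : Fin n → ℝ) :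
    T * (x ⬝ᵥ x) ≤ (Mᵀ *ᵥ x) ⬝ᵥ (Mᵀ *ᵥ x) := by
  have hx := dotProduct_self_nonneg_real x
  have ha := dotProduct_self_nonneg_real (Mᵀ *ᵥ x)
  rcases le_or_gt T 0 with hT | hT
  · nlinarith
  have hinj : Function.Injective M.mulVecLin := by
    rw [← LinearMap.ker_eq_bot, LinearMap.ker_eq_bot']
    intro v hv
    have hv' : M *ᵥ v = 0 := hv
    have h1 := h v
    rw [hv', dotProduct_zero] at h1
    exact dotProduct_self_eq_zero.1
      (le_antisymm (by nlinarith) (dotProduct_self_nonneg_real v))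
  obtain ⟨y, hy⟩ := LinearMap.injective_iff_surjective.1 hinj x
  have hy' : M *ᵥ y = x := hy
  have h1 := h y
  have h2 := dotProduct_sq_le y (Mᵀ *ᵥ x)
  rw [← mulVec_dotProduct_eq, hy'] at h2
  rw [hy'] at h1
  rcases hx.eq_or_lt with h0 | h0
  · rw [← h0, mul_zero]; exact ha
  · refine le_of_mul_le_mul_right ?_ h0
    nlinarith [mul_le_mul_of_nonneg_right h1 ha]

/-- If `s ≤ MᵀM ≤ s + L` then `(MᵀM - s)² ≤ L (MᵀM - s)`, as quadratic forms. -/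
theorem gram_sub_smul_sq_le {M : Matrix (Fin m) (Fin n) ℝ} {s L : ℝ} (hs : 0 ≤ s) (hL : 0 < L)
    (hlow : ∀ v, s * (v ⬝ᵥ v) ≤ (M *ᵥ v) ⬝ᵥ (M *ᵥ v))
    (hup : ∀ v, (M *ᵥ v) ⬝ᵥ (M *ᵥ v) ≤ L * (v ⬝ᵥ v)) (w : Fin n → ℝ) :
    (Mᵀ *ᵥ (M *ᵥ w) - s • w) ⬝ᵥ (Mᵀ *ᵥ (M *ᵥ w) - s • w) ≤
      L * ((M *ᵥ w) ⬝ᵥ (M *ᵥ w) - s * (w ⬝ᵥ w)) := by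
  set y := Mᵀ *ᵥ (M *ᵥ w) - s • w with hy
  have hMy : (M *ᵥ w) ⬝ᵥ (M *ᵥ y) = y ⬝ᵥ y + s * (w ⬝ᵥ y) := by
    rw [← transpose_mulVec_dotProduct_eq]
    conv_rhs => lhs; rw [hy]
    rw [sub_dotProduct, smul_dotProduct, smul_eq_mul, hy]
    ring
  have h1 := hlow (L • w - y)
  have h2 := hup y
  have hyy := dotProduct_self_nonneg_real y
  simp only [mulVec_sub, mulVec_smul, sub_dotProduct, dotProduct_sub, smul_dotProduct,
    dotProduct_smul, smul_eq_mul, dotProduct_comm (M *ᵥ y) (M *ᵥ w), hMy,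
    dotProduct_comm y w] at h1
  refine le_of_mul_le_mul_left ?_ hL
  nlinarith [mul_nonneg hs hyy]

end SingularValues

/-- One gradient step on the top block `U`, in the direction `v`: `ℓ` are the leading
eigenvalues, with minimum `μ` and upper bound `lam1`. -/
theorem topBlock_step_lower_bound {r k : ℕ} (U : Matrix (Fin r) (Fin r) ℝ)
    (J : Matrix (Fin k) (Fin r) ℝ) (ℓ : Fin r → ℝ) {μ lam1 η s j : ℝ}
    (hμ : 0 ≤ μ) (hμℓ : ∀ i, μ ≤ ℓ i) (hℓ : ∀ i, ℓ i ≤ lam1) (hμ1 : μ ≤ lam1)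
    (hlam1 : 0 < lam1) (hη : 0 < η) (hηlam : 32 * (η * lam1) ≤ 1)
    (hs : 0 ≤ s) (hs2 : s ≤ 2 * lam1) (hj2 : j ≤ 2 * lam1)
    (hlow : ∀ x, s * (x ⬝ᵥ x) ≤ (U *ᵥ x) ⬝ᵥ (U *ᵥ x))
    (hup : ∀ x, (U *ᵥ x) ⬝ᵥ (U *ᵥ x) ≤ 2 * lam1 * (x ⬝ᵥ x))
    (hJ : ∀ x, (J *ᵥ x) ⬝ᵥ (J *ᵥ x) ≤ j * (x ⬝ᵥ x)) (v : Fin r → ℝ) :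
    ((1 + 2 * η * (μ - j - s)) * s - 4 * η ^ 2 * lam1 ^ 3) * (v ⬝ᵥ v) ≤
      ((U + η • (diagonal ℓ * U - U * (Uᵀ * U + Jᵀ * J)))ᵀ *ᵥ v) ⬝ᵥ
        ((U + η • (diagonal ℓ * U - U * (Uᵀ * U + Jᵀ * J)))ᵀ *ᵥ v) := by
  set Dv : Fin r → ℝ := fun i => (ℓ i - μ) * v i with hDv
  set w : Fin r → ℝ := v + η • Dv with hw
  set z := Uᵀ *ᵥ v with hz
  set p := Uᵀ *ᵥ Dv with hp
  set q := Uᵀ *ᵥ w with hq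
  set K := Uᵀ * U + Jᵀ * J with hK
  have hqzp : q = z + η • p := by rw [hq, hw, mulVec_add, mulVec_smul]
  have hKdot : ∀ x y, x ⬝ᵥ (K *ᵥ y) = (U *ᵥ x) ⬝ᵥ (U *ᵥ y) + (J *ᵥ x) ⬝ᵥ (J *ᵥ y) := by
    intro x y
    rw [hK, add_mulVec, dotProduct_add, ← mulVec_mulVec, ← mulVec_mulVec, mulVec_dotProduct_eq,
      mulVec_dotProduct_eq]
  have hKT : Kᵀ = K := by simp [hK]
  have hdiag : diagonal ℓ *ᵥ v = Dv + μ • v := by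
    ext i
    simp only [mulVec_diagonal, hDv, Pi.add_apply, Pi.smul_apply, smul_eq_mul]
    ring
  have hstep : (U + η • (diagonal ℓ * U - U * K))ᵀ *ᵥ v = q - η • (K *ᵥ z - μ • z) := by
    rw [transpose_add, transpose_smul, transpose_sub, transpose_mul, transpose_mul, hKT,
      diagonal_transpose, add_mulVec, smul_mulVec, sub_mulVec, ← mulVec_mulVec, ← mulVec_mulVec,
      hdiag, mulVec_add, mulVec_smul, ← hz, ← hp, hqzp]
    module
  have hupT := transpose_mulVec_sq_le (by positivity) hup
  have hlowT := le_transpose_mulVec_sq hlow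
  have hDle : Dv ⬝ᵥ Dv ≤ lam1 ^ 2 * (v ⬝ᵥ v) := by
    simp only [dotProduct, Finset.mul_sum]
    refine Finset.sum_le_sum fun i _ => ?_
    have h1 : (ℓ i - μ) ^ 2 ≤ lam1 ^ 2 :=
      pow_le_pow_left₀ (by linarith [hμℓ i]) (by linarith [hℓ i]) 2
    nlinarith [mul_le_mul_of_nonneg_right h1 (mul_self_nonneg (v i))]
  have hvw : v ⬝ᵥ v ≤ w ⬝ᵥ w := by
    have h1 : 0 ≤ v ⬝ᵥ Dv := Finset.sum_nonneg fun i _ => by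
      nlinarith [mul_nonneg (sub_nonneg.2 (hμℓ i)) (mul_self_nonneg (v i))]
    have h2 := dotProduct_self_nonneg_real Dv
    simp only [hw, add_dotProduct, dotProduct_add, smul_dotProduct, dotProduct_smul, smul_eq_mul,
      dotProduct_comm Dv v]
    nlinarith [mul_nonneg hη.le h1, mul_nonneg (mul_nonneg hη.le hη.le) h2]
  have hpp : p ⬝ᵥ p ≤ 2 * lam1 ^ 3 * (v ⬝ᵥ v) := by
    nlinarith [hupT Dv]
  have hexpand : (q - η • (K *ᵥ z - μ • z)) ⬝ᵥ (q - η • (K *ᵥ z - μ • z)) =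
      q ⬝ᵥ q - 2 * η * (q ⬝ᵥ (K *ᵥ q) - μ * (q ⬝ᵥ q))
        + 2 * η ^ 3 * (p ⬝ᵥ (K *ᵥ p) - μ * (p ⬝ᵥ p))
        + η ^ 2 * ((K *ᵥ z - μ • z + p) ⬝ᵥ (K *ᵥ z - μ • z + p) - p ⬝ᵥ p) := by
    have hsymm : ∀ x y, x ⬝ᵥ (K *ᵥ y) = y ⬝ᵥ (K *ᵥ x) := fun x y => by
      rw [hKdot, hKdot, dotProduct_comm (U *ᵥ x), dotProduct_comm (J *ᵥ x)]
    rw [hqzp]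
    simp only [mulVec_add, mulVec_smul, sub_dotProduct, dotProduct_sub, add_dotProduct,
      dotProduct_add, smul_dotProduct, dotProduct_smul, smul_eq_mul,
      dotProduct_comm (K *ᵥ z) z, dotProduct_comm (K *ᵥ z) p, dotProduct_comm p z, hsymm p z]
    ring
  have hKp : 0 ≤ p ⬝ᵥ (K *ᵥ p) := by
    rw [hKdot]
    exact add_nonneg (dotProduct_self_nonneg_real _) (dotProduct_self_nonneg_real _)
  have hgram := gram_sub_smul_sq_le (M := Uᵀ) hs (by positivity : 0 < 2 * lam1) hlowT hupT w
  rw [transpose_transpose, ← hq] at hgram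
  have hUqw : (U *ᵥ q) ⬝ᵥ w = q ⬝ᵥ q := by rw [mulVec_dotProduct_eq]
  simp only [sub_dotProduct, dotProduct_sub, smul_dotProduct, dotProduct_smul, smul_eq_mul,
    dotProduct_comm w (U *ᵥ q), hUqw] at hgram
  have hqlow := hlowT w
  rw [← hq] at hqlow
  have hJq := hJ q
  have hsquare := dotProduct_self_nonneg_real (K *ᵥ z - μ • z + p)
  have hηs : η * s ≤ 2 * (η * lam1) := by nlinarith
  have hηj : η * j ≤ 2 * (η * lam1) := by nlinarith
  have hημ : η * μ ≤ η * lam1 := by nlinarith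
  have hfirst : (1 + 2 * η * (μ - j - s)) * s * (w ⬝ᵥ w) ≤
      q ⬝ᵥ q - 2 * η * (q ⬝ᵥ (K *ᵥ q) - μ * (q ⬝ᵥ q)) := by
    rw [hKdot]
    have hcoef : 0 ≤ 1 + 2 * η * μ - 2 * η * j - 2 * η * (2 * lam1 + 2 * s) := by nlinarith
    have hA := mul_nonneg hcoef (sub_nonneg.2 hqlow)
    have hG := mul_le_mul_of_nonneg_left hgram hη.le
    have hJ' := mul_le_mul_of_nonneg_left hJq hη.le
    linear_combination hA + 2 * hG + 2 * hJ'
  have hT : 0 ≤ (1 + 2 * η * (μ - j - s)) * s := mul_nonneg (by nlinarith) hs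
  have hTw := mul_le_mul_of_nonneg_left hvw hT
  have hη2 : 0 ≤ η ^ 2 := by positivity
  have hpp0 := dotProduct_self_nonneg_real p
  have herr : η ^ 2 * (1 + 2 * (η * μ)) * (p ⬝ᵥ p) ≤ 4 * η ^ 2 * lam1 ^ 3 * (v ⬝ᵥ v) := by
    have h1 : η ^ 2 * (1 + 2 * (η * μ)) * (p ⬝ᵥ p) ≤ η ^ 2 * 2 * (p ⬝ᵥ p) := by
      gcongr
      linarith
    nlinarith [mul_le_mul_of_nonneg_left hpp hη2]
  rw [hstep, hexpand]
  have h3 : 0 ≤ 2 * η ^ 3 * (p ⬝ᵥ (K *ᵥ p)) := by positivity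
  have h4 := mul_nonneg hη2 hsquare
  linarith

theorem sum_top_add_sum_bot {d r : ℕ} (h : r ≤ d) (f : Fin d → ℝ) :
    ∑ i, f i = ∑ i : Fin r, f (Fin.castLE h i) +
      ∑ i : Fin (d - r), f ⟨r + (i : ℕ), by have := i.isLt; omega⟩ := by
  obtain ⟨k, rfl⟩ := Nat.exists_eq_add_of_le h
  rw [Fin.sum_univ_add]
  congr 1
  exact (Fintype.sum_equiv (finCongr (by omega)) _ _ fun _ => rfl)

theorem transpose_mul_self_eq_blocks {d r : ℕ} (h : r ≤ d) (X : Matrix (Fin d) (Fin r) ℝ) :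
    Xᵀ * X = (topBlock h X)ᵀ * topBlock h X + (botBlock X)ᵀ * botBlock X := by
  ext a b
  simp only [Matrix.add_apply, mul_apply, transpose_apply]
  exact sum_top_add_sum_bot h _

theorem mulVec_sq_eq_blocks {d r : ℕ} (h : r ≤ d) (X : Matrix (Fin d) (Fin r) ℝ)
    (v : Fin r → ℝ) :
    (X *ᵥ v) ⬝ᵥ (X *ᵥ v) = (topBlock h X *ᵥ v) ⬝ᵥ (topBlock h X *ᵥ v) +
      (botBlock X *ᵥ v) ⬝ᵥ (botBlock X *ᵥ v) :=
  sum_top_add_sum_bot h _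

theorem topBlock_gd_step {d r : ℕ} (h : r ≤ d) (lam : Fin d → ℝ) (η : ℝ)
    (X : Matrix (Fin d) (Fin r) ℝ) :
    topBlock h (X + η • ((diagonal lam - X * Xᵀ) * X)) =
      topBlock h X + η • (diagonal (fun i => lam (Fin.castLE h i)) * topBlock h X -
        topBlock h X * ((topBlock h X)ᵀ * topBlock h X + (botBlock X)ᵀ * botBlock X)) := by
  rw [← transpose_mul_self_eq_blocks, Matrix.sub_mul, Matrix.mul_assoc]
  ext i j
  simp only [topBlock, Matrix.add_apply, Matrix.smul_apply, Matrix.sub_apply, diagonal_mul]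
  rfl

/-- Lemma A.6: one-step lower bound on `σ_r(U_t)²`. -/
theorem U_one_step (d r : ℕ) (hr : 0 < r) (hrd : r < d)
    (lam : Fin d → ℝ)
    (hmono : ∀ i j : Fin d, i ≤ j → lam j ≤ lam i)
    (hnn : ∀ i, 0 ≤ lam i)
    (hlam1 : 0 < lam ⟨0, by omega⟩)
    (η : ℝ) (hη : 0 < η)
    (hηle : η ≤ 1 / (32 * lam ⟨0, by omega⟩))
    (X0 : Matrix (Fin d) (Fin r) ℝ) (t : ℕ)
    (hXt : sigmaMax (gdIter (Matrix.diagonal lam) η X0 t) ≤ Real.sqrt (2 * lam ⟨0, by omega⟩)) :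
    (1 + 2 * η * (lam ⟨r - 1, by omega⟩ -
        sigmaMax (botBlock (gdIter (Matrix.diagonal lam) η X0 t)) ^ 2 -
        sigmaMin (topBlock hrd.le (gdIter (Matrix.diagonal lam) η X0 t)) ^ 2)) *
      sigmaMin (topBlock hrd.le (gdIter (Matrix.diagonal lam) η X0 t)) ^ 2 -
      4 * η ^ 2 * lam ⟨0, by omega⟩ ^ 3 ≤
    sigmaMin (topBlock hrd.le (gdIter (Matrix.diagonal lam) η X0 (t + 1))) ^ 2 := by
  set X := gdIter (Matrix.diagonal lam) η X0 t
  have hL : 0 ≤ 2 * lam ⟨0, by omega⟩ := by positivity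
  have hXsq : sigmaMax X ^ 2 ≤ 2 * lam ⟨0, by omega⟩ :=
    (Real.le_sqrt (sigmaMax_nonneg X) hL).1 hXt
  have hXv : ∀ v, (X *ᵥ v) ⬝ᵥ (X *ᵥ v) ≤ 2 * lam ⟨0, by omega⟩ * (v ⬝ᵥ v) := fun v =>
    (le_sigmaMax_sq_mul X v).trans
      (mul_le_mul_of_nonneg_right hXsq (dotProduct_self_nonneg_real v))
  have hUv : ∀ v, (topBlock hrd.le X *ᵥ v) ⬝ᵥ (topBlock hrd.le X *ᵥ v) ≤
      2 * lam ⟨0, by omega⟩ * (v ⬝ᵥ v) := fun v => by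
    linarith [hXv v, mulVec_sq_eq_blocks hrd.le X v,
      dotProduct_self_nonneg_real (botBlock X *ᵥ v)]
  have hJv : ∀ v, (botBlock X *ᵥ v) ⬝ᵥ (botBlock X *ᵥ v) ≤
      2 * lam ⟨0, by omega⟩ * (v ⬝ᵥ v) := fun v => by
    linarith [hXv v, mulVec_sq_eq_blocks hrd.le X v,
      dotProduct_self_nonneg_real (topBlock hrd.le X *ᵥ v)]
  have hs2 : sigmaMin (topBlock hrd.le X) ^ 2 ≤ 2 * lam ⟨0, by omega⟩ := by
    obtain ⟨c, hc⟩ := unitImageNorms_nonempty hr (topBlock hrd.le X)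
    obtain ⟨v, hv, -⟩ := exists_sq_eq_of_mem_unitImageNorms hc
    simpa [hv] using (sigmaMin_sq_mul_le (topBlock hrd.le X) v).trans (hUv v)
  have hstep : topBlock hrd.le (gdIter (Matrix.diagonal lam) η X0 (t + 1)) = _ :=
    topBlock_gd_step hrd.le lam η X
  have hηlam : 32 * (η * lam ⟨0, by omega⟩) ≤ 1 := by
    rw [le_div_iff₀ (by positivity)] at hηle
    linarith
  refine le_sigmaMin_sq hr fun v => ?_
  rw [hstep]
  have key := le_transpose_mulVec_sq (topBlock_step_lower_bound (topBlock hrd.le X) (botBlock X)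
    (fun i => lam (Fin.castLE hrd.le i)) (hnn ⟨r - 1, by omega⟩)
    (fun i => hmono _ _ (Fin.le_def.2 (Nat.le_sub_one_of_lt i.isLt)))
    (fun i => hmono _ _ (Fin.le_def.2 (Nat.zero_le _)))
    (hmono _ _ (Fin.le_def.2 (Nat.zero_le _))) hlam1 hη hηlam (sq_nonneg _) hs2
    (sigmaMax_sq_le hL hJv) (sigmaMin_sq_mul_le _) hUv (le_sigmaMax_sq_mul _)) v
  rwa [transpose_transpose] at key
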